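/- Let I ⊂ S be a monomial ideal minimally generated by two monomials u_1, u_2 ∈ S. Then slength(I) = min{deg(u_1), deg(u_2)} − deg(gcd(u_1, u_2)) + 1. -/

import Mathlib

open MvPolynomial

/-- The set of exponent vectors of the monomials in the Stanley space `x^u · K[Z]`. -/
def stanleySet {σ : Type} (u : σ →₀ ℕ) (Z : Set σ) : Set (σ →₀ ℕ) :=
  {w | ∃ v : σ →₀ ℕ, ↑v.support ⊆ Z ∧ w = u + v}

/-- A Stanley decomposition (partition into Stanley spaces) of a set `P` of
exponent vectors of monomials.  By the standard correspondence, Stanley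
decompositions of a multigraded `K`-vector subquotient of `S` spanned by the
monomials with exponents in `P` correspond exactly to such partitions. -/
structure StanleyPartition {σ : Type} (P : Set (σ →₀ ℕ)) where
  r : ℕ
  base : Fin r → σ →₀ ℕ
  vars : Fin r → Set σ
  cover : P = ⋃ i, stanleySet (base i) (vars i)
  disj : ∀ i j, i ≠ j → Disjoint (stanleySet (base i) (vars i)) (stanleySet (base j) (vars j))

/-- The Stanley length of `P`: the minimal length of a Stanley decomposition. -/
noncomputable def slength {σ : Type} (P : Set (σ →₀ ℕ)) : ℕ :=
  sInf {r | ∃ D : StanleyPartition P, D.r = r}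

/-- The set of exponent vectors of the monomials belonging to an ideal. -/
def monSet {σ K : Type} [Field K] (I : Ideal (MvPolynomial σ K)) : Set (σ →₀ ℕ) :=
  {d | (monomial d (1 : K) : MvPolynomial σ K) ∈ I}

/-- `I` is a monomial ideal. -/
def IsMonomialIdeal {σ K : Type} [Field K] (I : Ideal (MvPolynomial σ K)) : Prop :=
  ∃ A : Set (σ →₀ ℕ), I = Ideal.span ((fun d => (monomial d (1 : K) : MvPolynomial σ K)) '' A)

/-- Exponent vectors of the minimal monomial generators of `I`. -/
def minGens {σ K : Type} [Field K] (I : Ideal (MvPolynomial σ K)) : Set (σ →₀ ℕ) :=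
  {d | d ∈ monSet I ∧ ∀ e ∈ monSet I, e ≤ d → e = d}

theorem mem_stanleySet_iff {σ : Type} {u w : σ →₀ ℕ} {Z : Set σ} :
    w ∈ stanleySet u Z ↔ u ≤ w ∧ ∀ k ∉ Z, w k = u k := by
  constructor
  · rintro ⟨v, hv, rfl⟩
    refine ⟨le_self_add, fun k hk => ?_⟩
    have : v k = 0 := by
      by_contra h
      exact hk (hv (by simpa using h))
    simp [this]
  · rintro ⟨hle, heq⟩
    refine ⟨w - u, fun k hk => ?_, (add_tsub_cancel_of_le hle).symm⟩
    by_contra h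
    simp [heq k h] at hk

theorem monSet_span_pair {σ K : Type} [Field K] (a b : σ →₀ ℕ) :
    monSet (Ideal.span {(monomial a (1 : K) : MvPolynomial σ K), monomial b (1 : K)}) =
      {d | a ≤ d ∨ b ≤ d} := by
  classical
  ext d
  have h := mem_ideal_span_monomial_image (R := K) (x := monomial d 1) (s := {a, b})
  rw [Set.image_pair] at h
  rw [monSet, Set.mem_ofPred_eq, h]
  simp [support_monomial]

/-- A partition into Stanley spaces indexed by a finite type can be reindexed by `Fin`. -/
theorem exists_stanleyPartition_of_fintype {σ ι : Type} [Fintype ι] {P : Set (σ →₀ ℕ)}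
    (base : ι → σ →₀ ℕ) (vars : ι → Set σ)
    (hmem : ∀ w ∈ P, ∃ i, w ∈ stanleySet (base i) (vars i))
    (hsub : ∀ i, stanleySet (base i) (vars i) ⊆ P)
    (huniq : ∀ i j w, w ∈ stanleySet (base i) (vars i) → w ∈ stanleySet (base j) (vars j) →
      i = j) :
    ∃ D : StanleyPartition P, D.r = Fintype.card ι := by
  let e := (Fintype.equivFin ι).symm
  refine ⟨⟨Fintype.card ι, base ∘ e, vars ∘ e, ?_, ?_⟩, rfl⟩
  · refine Set.Subset.antisymm (fun w hw => ?_) (Set.iUnion_subset fun i => hsub (e i))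
    obtain ⟨i, hi⟩ := hmem w hw
    exact Set.mem_iUnion.2 ⟨e.symm i, by simpa using hi⟩
  · intro i j hij
    exact Set.disjoint_left.2 fun w hi hj => hij (e.injective (huniq _ _ w hi hj))

/-- The cone over `a` together with slices of the rest of the cone over `b`: a vector `w ≥ b`
outside the cone over `a` is sorted by the first index `i` with `w i < a i`. -/
theorem exists_stanleyPartition_pair {n : ℕ} (a b : Fin n →₀ ℕ) :
    ∃ D : StanleyPartition {d | a ≤ d ∨ b ≤ d}, D.r = ∑ i, (a i - b i) + 1 := by
  classical
  let base : Option (Σ i, Fin (a i - b i)) → Fin n →₀ ℕ := fun o => o.elim a fun p =>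
    Finsupp.equivFunOnFinite.symm fun k =>
      if k < p.1 then max (a k) (b k) else if k = p.1 then b k + p.2 else b k
  let vars : Option (Σ i, Fin (a i - b i)) → Set (Fin n) := fun o =>
    o.elim Set.univ fun p => {p.1}ᶜ
  have hnone (w) : w ∈ stanleySet (base none) (vars none) ↔ a ≤ w := by
    simp [mem_stanleySet_iff, base, vars]
  have hsome (p : Σ i, Fin (a i - b i)) (w) :
      w ∈ stanleySet (base (some p)) (vars (some p)) ↔
        b ≤ w ∧ (∀ k < p.1, a k ≤ w k) ∧ w p.1 = b p.1 + p.2 := by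
    simp only [mem_stanleySet_iff, base, vars, Finsupp.le_def, Option.elim]
    constructor
    · rintro ⟨h, h'⟩
      refine ⟨fun k => ?_, fun k hk => ?_, by simpa using h' p.1⟩
      · have := h k
        simp only [Finsupp.equivFunOnFinite_symm_apply_apply] at this
        split_ifs at this <;> omega
      · have := h k
        simp only [Finsupp.equivFunOnFinite_symm_apply_apply, if_pos hk] at this
        omega
    · rintro ⟨h, h', h''⟩
      refine ⟨fun k => ?_, by simpa using h''⟩
      simp only [Finsupp.equivFunOnFinite_symm_apply_apply]
      split_ifs with h1 h2
      · exact max_le (h' k h1) (h k)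
      · subst h2; exact h''.ge
      · exact h k
  have hlt (p : Σ i, Fin (a i - b i)) {w : Fin n →₀ ℕ} (h : w p.1 = b p.1 + p.2) :
      w p.1 < a p.1 := by
    have := p.2.isLt
    omega
  have hcard : Fintype.card (Option (Σ i, Fin (a i - b i))) = ∑ i, (a i - b i) + 1 := by simp
  rw [← hcard]
  refine exists_stanleyPartition_of_fintype base vars ?_ ?_ ?_
  · intro w hw
    by_cases haw : a ≤ w
    · exact ⟨none, (hnone w).2 haw⟩
    have hbw : b ≤ w := hw.resolve_left haw
    have hex : (Finset.univ.filter fun i => w i < a i).Nonempty := by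
      by_contra hne
      refine haw fun i => not_lt.1 fun hi => hne ⟨i, by simpa using hi⟩
    obtain ⟨i, hi, hmin⟩ := Finset.exists_min_image _ id hex
    simp only [Finset.mem_filter, Finset.mem_univ, true_and, id] at hi hmin
    have hbi := hbw i
    refine ⟨some ⟨i, ⟨w i - b i, by omega⟩⟩, (hsome _ w).2 ⟨hbw, fun k hk => ?_, ?_⟩⟩
    · exact not_lt.1 fun h => (hmin k h).not_gt hk
    · exact (add_tsub_cancel_of_le hbi).symm
  · rintro (_ | p) w hw
    · exact Or.inl ((hnone w).1 hw)
    · exact Or.inr ((hsome p w).1 hw).1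
  · rintro (_ | p) (_ | q) w hp hq
    · rfl
    · exact absurd ((hnone w).1 hp q.1) (hlt q ((hsome q w).1 hq).2.2).not_ge
    · exact absurd ((hnone w).1 hq p.1) (hlt p ((hsome p w).1 hp).2.2).not_ge
    · obtain ⟨-, hp1, hp2⟩ := (hsome p w).1 hp
      obtain ⟨-, hq1, hq2⟩ := (hsome q w).1 hq
      have hpq : p.1 = q.1 := by
        rcases lt_trichotomy p.1 q.1 with h | h | h
        · exact absurd (hq1 _ h) (hlt p hp2).not_ge
        · exact h
        · exact absurd (hp1 _ h) (hlt q hq2).not_ge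
      obtain ⟨i, j⟩ := p
      obtain ⟨i', j'⟩ := q
      obtain rfl : i = i' := hpq
      have : j = j' := Fin.ext (by simp only at hp2 hq2; omega)
      rw [this]

/-- If the Stanley space of `D` containing a large constant vector `M` has base `≥ a`, then `D` has
a separate Stanley space for each pair `(i, j)` with `b i ≤ j < a i`, namely the one containing the
vector with `i`-th entry `j` and all other entries `M`. -/
theorem StanleyPartition.sum_tsub_lt_of_le_base {n : ℕ} {P : Set (Fin n →₀ ℕ)}
    (D : StanleyPartition P) {a b : Fin n →₀ ℕ} (hP : ∀ w, b ≤ w → w ∈ P) {M : ℕ}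
    (hb : ∀ k, b k ≤ M) (hbase : ∀ i k, D.base i k < M) {i₀ : Fin D.r}
    (hi₀ : Finsupp.equivFunOnFinite.symm (fun _ => M) ∈ stanleySet (D.base i₀) (D.vars i₀))
    (ha : a ≤ D.base i₀) :
    ∑ i, (a i - b i) + 1 ≤ D.r := by
  classical
  let pt : (Σ i, Fin (a i - b i)) → Fin n →₀ ℕ := fun p =>
    Finsupp.equivFunOnFinite.symm fun k => if k = p.1 then b k + p.2 else M
  have pt_self (p) : pt p p.1 = b p.1 + p.2 := by simp [pt]
  have pt_ne (p) {k} (hk : k ≠ p.1) : pt p k = M := by simp [pt, hk]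
  have hpt (p) : ∃ i, pt p ∈ stanleySet (D.base i) (D.vars i) := by
    rw [← Set.mem_iUnion, ← D.cover]
    refine hP _ fun k => ?_
    by_cases hk : k = p.1
    · subst hk; rw [pt_self]; exact Nat.le_add_right _ _
    · rw [pt_ne p hk]; exact hb k
  choose f hf using hpt
  have hvars (p) {k} (hk : k ≠ p.1) : k ∈ D.vars (f p) := by
    by_contra h
    have := (mem_stanleySet_iff.1 (hf p)).2 k h
    rw [pt_ne p hk] at this
    exact (hbase (f p) k).ne' this
  have hne (p) : f p ≠ i₀ := by
    intro h
    have h1 := (mem_stanleySet_iff.1 (hf p)).1 p.1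
    rw [h, pt_self] at h1
    have h2 := ha p.1
    have := p.2.isLt
    omega
  have hself (p) : p.1 ∉ D.vars (f p) := by
    intro h
    refine Set.disjoint_left.1 (D.disj _ _ (hne p)) (mem_stanleySet_iff.2 ⟨fun k => ?_, ?_⟩) hi₀
    · exact (hbase _ k).le
    · intro k hk
      by_cases hkp : k = p.1
      · exact absurd (hkp ▸ h) hk
      · exact absurd (hvars p hkp) hk
  have hinj : Function.Injective f := by
    intro p q hpq
    have h1 : p.1 = q.1 := by
      by_contra h
      exact hself p (hpq ▸ hvars q h)
    have h2 := (mem_stanleySet_iff.1 (hf p)).2 _ (hself p)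
    have h3 := (mem_stanleySet_iff.1 (hf q)).2 _ (hself q)
    rw [pt_self] at h2 h3
    obtain ⟨i, j⟩ := p
    obtain ⟨i', j'⟩ := q
    obtain rfl : i = i' := h1
    rw [← hpq] at h3
    have : j = j' := Fin.ext (by simp only at h2 h3; omega)
    rw [this]
  let g : Option (Σ i, Fin (a i - b i)) → Fin D.r := fun o => o.elim i₀ f
  have hg : Function.Injective g := by
    rintro (_ | p) (_ | q) h
    · rfl
    · exact absurd h.symm (hne q)
    · exact absurd h (hne p)
    · exact congrArg some (hinj h)
  simpa using Fintype.card_le_of_injective g hg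

theorem StanleyPartition.sum_tsub_lt_or {n : ℕ} {a b : Fin n →₀ ℕ}
    (D : StanleyPartition {d | a ≤ d ∨ b ≤ d}) :
    ∑ i, (a i - b i) + 1 ≤ D.r ∨ ∑ i, (b i - a i) + 1 ≤ D.r := by
  let M := ∑ k, a k + ∑ k, b k + ∑ i, ∑ k, D.base i k + 1
  have le_sum (c : Fin n → ℕ) (k) : c k ≤ ∑ k, c k :=
    Finset.single_le_sum (fun _ _ => Nat.zero_le _) (Finset.mem_univ k)
  have hMa (k) : a k ≤ M := by have := le_sum a k; omega
  have hMb (k) : b k ≤ M := by have := le_sum b k; omega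
  have hM (i k) : D.base i k < M := by
    have h1 := le_sum (D.base i) k
    have h2 : ∑ k, D.base i k ≤ ∑ i, ∑ k, D.base i k :=
      Finset.single_le_sum (f := fun i => ∑ k, D.base i k) (fun _ _ => Nat.zero_le _)
        (Finset.mem_univ i)
    omega
  have hmem : Finsupp.equivFunOnFinite.symm (fun _ => M) ∈
      ⋃ i, stanleySet (D.base i) (D.vars i) := by
    rw [← D.cover]
    exact Or.inl fun k => hMa k
  obtain ⟨i₀, hi₀⟩ := Set.mem_iUnion.1 hmem
  have hbase : D.base i₀ ∈ {d | a ≤ d ∨ b ≤ d} := by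
    have : D.base i₀ ∈ ⋃ i, stanleySet (D.base i) (D.vars i) :=
      Set.mem_iUnion.2 ⟨i₀, mem_stanleySet_iff.2 ⟨le_rfl, fun _ _ => rfl⟩⟩
    rwa [← D.cover] at this
  rcases hbase with h | h
  · exact Or.inl (D.sum_tsub_lt_of_le_base (fun _ => Or.inr) hMb hM hi₀ h)
  · exact Or.inr (D.sum_tsub_lt_of_le_base (fun _ => Or.inl) hMa hM hi₀ h)

theorem slength_pair {n : ℕ} (a b : Fin n →₀ ℕ) :
    slength {d | a ≤ d ∨ b ≤ d} = min (∑ i, (a i - b i)) (∑ i, (b i - a i)) + 1 := by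
  obtain ⟨D₁, h₁⟩ := exists_stanleyPartition_pair a b
  have hswap : {d : Fin n →₀ ℕ | b ≤ d ∨ a ≤ d} = {d | a ≤ d ∨ b ≤ d} :=
    Set.ext fun _ => or_comm
  obtain ⟨D₂, h₂⟩ := hswap ▸ exists_stanleyPartition_pair b a
  have le₁ : slength {d | a ≤ d ∨ b ≤ d} ≤ _ := Nat.sInf_le ⟨D₁, h₁⟩
  have le₂ : slength {d | a ≤ d ∨ b ≤ d} ≤ _ := Nat.sInf_le ⟨D₂, h₂⟩
  obtain ⟨D, hD⟩ := Nat.sInf_mem (s := {r | ∃ D : StanleyPartition {d | a ≤ d ∨ b ≤ d}, D.r = r})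
    ⟨_, D₁, rfl⟩
  change D.r = slength _ at hD
  have := D.sum_tsub_lt_or
  omega

/-- If `I` is minimally generated by two monomials `u_1, u_2`
(i.e. neither divides the other), then
`slength(I) = min{deg u_1, deg u_2} − deg(gcd(u_1,u_2)) + 1`. -/
theorem stmt_17 {K : Type} [Field K] {n : ℕ} (a b : Fin n →₀ ℕ)
    (hab : ¬ a ≤ b) (hba : ¬ b ≤ a) :
    slength (monSet (Ideal.span
        {(monomial a (1 : K) : MvPolynomial (Fin n) K), monomial b (1 : K)})) =
      min (∑ j, a j) (∑ j, b j) - (∑ j, min (a j) (b j)) + 1 := by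
  have h₁ : ∑ j, (a j - b j) + ∑ j, min (a j) (b j) = ∑ j, a j := by
    rw [← Finset.sum_add_distrib]
    exact Finset.sum_congr rfl fun j _ => by omega
  have h₂ : ∑ j, (b j - a j) + ∑ j, min (a j) (b j) = ∑ j, b j := by
    rw [← Finset.sum_add_distrib]
    exact Finset.sum_congr rfl fun j _ => by omega
  rw [monSet_span_pair, slength_pair]
  omega
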